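/- arXiv:2512.12152 — 4 statements merged into one kernel-verified Lean document; each statement's English description precedes it below -/
import Mathlib

section
/- If p ∈ P_4 satisfies p = ∂_x p = ∂_y p = ∂_{xy} p = 0 at each of the four vertices (0,0), (1,0), (1,1), (0,1) of the unit square, and p vanishes at the four edge midpoints (1/2,0), (1,1/2), (1/2,1), (0,1/2), then p = 0. -/
open MvPolynomial

noncomputable section

/-- A bivariate real polynomial; variable `0` is `x`, variable `1` is `y`. -/
abbrev Poly2 : Type := MvPolynomial (Fin 2) ℝ

/-- Evaluation of a bivariate polynomial at the point `(a, b)`. -/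
def ev (p : Poly2) (a b : ℝ) : ℝ := MvPolynomial.eval ![a, b] p

/-- The partial derivative `∂ₓ`. -/
def dX (p : Poly2) : Poly2 := MvPolynomial.pderiv 0 p

/-- The partial derivative `∂_y`. -/
def dY (p : Poly2) : Poly2 := MvPolynomial.pderiv 1 p

/-- A bivariate polynomial of total degree at most `n` is the sum of its monomials `x ^ i * y ^ j`
with `i + j ≤ n`. -/
theorem eq_sum_of_totalDegree_le {p : Poly2} {n : ℕ} (hp : p.totalDegree ≤ n) :
    p = ∑ i ∈ Finset.range (n + 1), ∑ j ∈ Finset.range (n + 1 - i),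
      C (p.coeff (Finsupp.single 0 i + Finsupp.single 1 j)) * X 0 ^ i * X 1 ^ j := by
  have hmon (i j : ℕ) (a : ℝ) : (C a * X 0 ^ i * X 1 ^ j : Poly2) =
      monomial (Finsupp.single 0 i + Finsupp.single 1 j) a := by
    rw [C_mul_X_pow_eq_monomial, X_pow_eq_monomial, monomial_mul, mul_one]
  have hexp (m : Fin 2 →₀ ℕ) (i j : ℕ) :
      Finsupp.single 0 i + Finsupp.single 1 j = m ↔ m 0 = i ∧ m 1 = j := by
    simp [Finsupp.ext_iff, Fin.forall_fin_two, eq_comm]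
  ext m
  have hm := (hexp m _ _).2 ⟨rfl, rfl⟩
  simp only [hmon, coeff_sum, coeff_monomial, hexp, ite_and, Finset.sum_ite_irrel,
    Finset.sum_const_zero, Finset.sum_ite_eq, Finset.mem_range, hm]
  by_cases h : m 0 + m 1 ≤ n
  · rw [if_pos (by omega), if_pos (by omega)]
  · have hzero : coeff m p = 0 := by
      refine coeff_eq_zero_of_totalDegree_lt (hp.trans_lt ?_)
      change n < m.degree
      rw [Finsupp.degree_eq_sum, Fin.sum_univ_two]
      omega
    simp [hzero]

/-- a `P₄` polynomial whose value and `∂ₓ`, `∂_y`, `∂ₓ_y` derivatives vanish at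
the four vertices of the unit square and whose value vanishes at the four edge midpoints
is zero. -/
theorem stmt_3
    (p : Poly2) (hp : p.totalDegree ≤ 4)
    (hvert : ∀ z ∈ ({(0, 0), (1, 0), (1, 1), (0, 1)} : Set (ℝ × ℝ)),
      ev p z.1 z.2 = 0 ∧ ev (dX p) z.1 z.2 = 0 ∧ ev (dY p) z.1 z.2 = 0 ∧
        ev (dX (dY p)) z.1 z.2 = 0)
    (hmid : ∀ z ∈ ({(1 / 2, 0), (1, 1 / 2), (1 / 2, 1), (0, 1 / 2)} : Set (ℝ × ℝ)),
      ev p z.1 z.2 = 0) :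
    p = 0 := by
  have hsum := eq_sum_of_totalDegree_le hp
  generalize hc : (fun i j : ℕ => p.coeff (Finsupp.single 0 i + Finsupp.single 1 j)) = c at hsum
  simp only [fun i j : ℕ => congrFun (congrFun hc i) j] at hsum
  clear hc hp
  simp only [Finset.sum_range_succ, Finset.sum_range_zero, Nat.reduceAdd, Nat.reduceSub] at hsum
  subst hsum
  have hnum (n : ℕ) [n.AtLeastTwo] : pderiv 0 (OfNat.ofNat n : Poly2) = 0 :=
    (pderiv 0).map_natCast n
  simp [ev, dX, dY, pderiv_X, hnum] at hvert hmid
  obtain ⟨⟨h00, h10, h01, h11⟩, ⟨hx, hxx, hxy, hxxy⟩, ⟨-, -, -, hxyxy⟩, hy, hyx, hyy, hyxy⟩ := hvert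
  obtain ⟨mbot, mright, mtop, mleft⟩ := hmid
  have h20 : c 2 0 = 0 := by linarith
  have h30 : c 3 0 = 0 := by linarith
  have h40 : c 4 0 = 0 := by linarith
  have h02 : c 0 2 = 0 := by linarith
  have h03 : c 0 3 = 0 := by linarith
  have h04 : c 0 4 = 0 := by linarith
  have h21 : c 2 1 = 0 := by linarith
  have h31 : c 3 1 = 0 := by linarith
  have h12 : c 1 2 = 0 := by linarith
  have h13 : c 1 3 = 0 := by linarith
  have h22 : c 2 2 = 0 := by linarith
  simp [h00, h10, h01, h11, h20, h30, h40, h02, h03, h04, h21, h31, h12, h13, h22]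
end
end

section
/- Let k ≥ 6. Suppose p ∈ P_k satisfies: p = ∂_x p = ∂_y p = ∂_{xy} p = 0 at each of the four vertices (0,0), (1,0), (1,1), (0,1) of the unit square; p(j/(k−2),0) = p(j/(k−2),1) = p(0,j/(k−2)) = p(1,j/(k−2)) = 0 for j = 1,…,k−3; ∂_y p(j/(k−3),0) = ∂_y p(j/(k−3),1) = ∂_x p(0,j/(k−3)) = ∂_x p(1,j/(k−3)) = 0 for j = 1,…,k−4; and p(i/(k−2), j/(k−2)) = 0 for all integers 1 ≤ j ≤ i ≤ k−7 (this last set of conditions being empty when k ≤ 7). Then p = 0. -/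
open MvPolynomial

noncomputable section

/-- The restriction of `p` to the line where variable `i` takes the value `c`, as a polynomial in
the remaining variable. -/
def restrictLine (i : Fin 2) (c : ℝ) : Poly2 →ₐ[ℝ] Polynomial ℝ :=
  aeval (Function.update (fun _ => Polynomial.X) i (Polynomial.C c))

theorem restrictLine_X_self (i : Fin 2) (c : ℝ) :
    restrictLine i c (X i) = Polynomial.C c := by
  simp [restrictLine]

theorem restrictLine_X_of_ne {i j : Fin 2} (h : j ≠ i) (c : ℝ) :
    restrictLine i c (X j) = Polynomial.X := by
  simp [restrictLine, h]

theorem eval_restrictLine_one (p : Poly2) (c t : ℝ) :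
    (restrictLine 1 c p).eval t = ev p t c := by
  unfold ev
  induction p using MvPolynomial.induction_on with
  | C a => simp [restrictLine]
  | add p q hp hq => simp [hp, hq]
  | mul_X p n hp =>
    simp only [map_mul, Polynomial.eval_mul, hp]
    fin_cases n <;> simp [restrictLine]

theorem eval_restrictLine_zero (p : Poly2) (c t : ℝ) :
    (restrictLine 0 c p).eval t = ev p c t := by
  unfold ev
  induction p using MvPolynomial.induction_on with
  | C a => simp [restrictLine]
  | add p q hp hq => simp [hp, hq]
  | mul_X p n hp =>
    simp only [map_mul, Polynomial.eval_mul, hp]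
    fin_cases n <;> simp [restrictLine]

theorem natDegree_restrictLine_le (i : Fin 2) (c : ℝ) (p : Poly2) :
    (restrictLine i c p).natDegree ≤ p.totalDegree := by
  refine (MvPolynomial.aeval_natDegree_le p le_rfl _ (n := 1) fun j => ?_).trans_eq (mul_one _)
  obtain rfl | h := eq_or_ne j i <;> simp [*]

theorem derivative_restrictLine {i j : Fin 2} (h : j ≠ i) (c : ℝ) (p : Poly2) :
    Polynomial.derivative (restrictLine i c p) = restrictLine i c (pderiv j p) := by
  induction p using MvPolynomial.induction_on with
  | C a => simp [restrictLine]
  | add p q hp hq => simp [hp, hq]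
  | mul_X p n hp =>
    obtain rfl | hn := eq_or_ne n i
    · simp [pderiv_X_of_ne h.symm, restrictLine_X_self, hp, mul_comm]
    · obtain rfl : n = j := by omega
      simp [restrictLine_X_of_ne hn, hp, mul_comm]

theorem X_sub_C_dvd_iff_restrictLine_eq_zero (i : Fin 2) (c : ℝ) (p : Poly2) :
    X i - C c ∣ p ↔ restrictLine i c p = 0 := by
  constructor
  · rintro ⟨q, rfl⟩
    rw [map_mul, map_sub, restrictLine_X_self]
    simp [restrictLine]
  · intro h
    obtain ⟨j, hj⟩ : ∃ j : Fin 2, j ≠ i := exists_ne i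
    let mk := Ideal.Quotient.mkₐ ℝ (Ideal.span {(X i - C c : Poly2)})
    have hX : mk (X i) = mk (C c) :=
      Ideal.Quotient.eq.mpr (Ideal.mem_span_singleton_self _)
    have hmk : mk = (mk.comp (Polynomial.aeval (X j))).comp (restrictLine i c) := by
      ext n
      obtain rfl | hn := eq_or_ne n i
      · simp only [AlgHom.comp_apply, restrictLine_X_self, Polynomial.aeval_C]
        exact hX
      · obtain rfl : n = j := by omega
        simp [restrictLine_X_of_ne hn]
    have hp : mk p = 0 := by rw [hmk]; simp [h]
    exact Ideal.mem_span_singleton.mp (Ideal.Quotient.eq_zero_iff_mem.mp hp)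

theorem totalDegree_X_sub_C (i : Fin 2) (c : ℝ) :
    (X i - C c : Poly2).totalDegree = 1 := by
  rw [sub_eq_add_neg, ← map_neg, totalDegree_add_eq_left_of_totalDegree_lt] <;> simp

theorem X_sub_C_ne_zero (i : Fin 2) (c : ℝ) : (X i - C c : Poly2) ≠ 0 := by
  intro h
  simpa [h] using totalDegree_X_sub_C i c

theorem prime_X_sub_C (i : Fin 2) (c : ℝ) : Prime (X i - C c : Poly2) := by
  refine ⟨X_sub_C_ne_zero i c, fun h => ?_, fun p q h => ?_⟩
  · simpa [restrictLine] using h.map (restrictLine i c)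
  · simpa only [X_sub_C_dvd_iff_restrictLine_eq_zero, map_mul, mul_eq_zero] using h

theorem not_X_sub_C_dvd_pow {i j : Fin 2} {c d : ℝ} (h : j ≠ i ∨ c ≠ d) (n : ℕ) :
    ¬(X i - C c : Poly2) ∣ (X j - C d) ^ n := by
  refine fun hdvd => ?_
  have hd := (prime_X_sub_C i c).dvd_of_dvd_pow hdvd
  rw [X_sub_C_dvd_iff_restrictLine_eq_zero, map_sub] at hd
  have hC : restrictLine i c (C d) = Polynomial.C d := by simp [restrictLine]
  rw [hC] at hd
  by_cases hji : j = i
  · subst hji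
    rw [restrictLine_X_self, ← Polynomial.C_sub, Polynomial.C_eq_zero, sub_eq_zero] at hd
    exact h.elim (fun h => h rfl) fun h => h hd
  · rw [restrictLine_X_of_ne hji] at hd
    exact Polynomial.X_sub_C_ne_zero d hd

theorem totalDegree_X_sub_C_sq_mul (i : Fin 2) (c : ℝ) {q : Poly2} (hq : q ≠ 0) :
    ((X i - C c) ^ 2 * q).totalDegree = q.totalDegree + 2 := by
  have h := X_sub_C_ne_zero i c
  rw [pow_two, mul_assoc, totalDegree_mul_of_isDomain h (mul_ne_zero h hq),
    totalDegree_mul_of_isDomain h hq, totalDegree_X_sub_C]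
  ring

/-- A univariate polynomial of degree at most `m + 3` that has double zeros at `0` and `1` and
vanishes at the `m` equispaced points in between is zero. -/
theorem eq_zero_of_double_zeros {f : Polynomial ℝ} {m : ℕ} (hdeg : f.natDegree ≤ m + 3)
    (h0 : f.eval 0 = 0) (h0' : f.derivative.eval 0 = 0)
    (h1 : f.eval 1 = 0) (h1' : f.derivative.eval 1 = 0)
    (hm : ∀ j : ℕ, 1 ≤ j → j ≤ m → f.eval ((j : ℝ) / (m + 1)) = 0) : f = 0 := by
  by_contra hf
  have hdvd {a : ℝ} (ha : f.eval a = 0) (ha' : f.derivative.eval a = 0) :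
      (Polynomial.X - Polynomial.C a) ^ 2 ∣ f :=
    (Polynomial.le_rootMultiplicity_iff hf).mp
      ((Polynomial.one_lt_rootMultiplicity_iff_isRoot hf).mpr ⟨ha, ha'⟩)
  have hcop : IsCoprime (Polynomial.X - Polynomial.C (0 : ℝ)) (Polynomial.X - Polynomial.C 1) :=
    Polynomial.isCoprime_X_sub_C_of_isUnit_sub (by norm_num)
  obtain ⟨g, rfl⟩ := hcop.pow.mul_dvd (hdvd h0 h0') (hdvd h1 h1')
  have hg : g ≠ 0 := right_ne_zero_of_mul hf
  refine hg (Polynomial.eq_zero_of_natDegree_lt_card_of_eval_eq_zero g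
    (f := fun j : Fin m => ((j + 1 : ℕ) : ℝ) / (m + 1)) ?_ ?_ ?_)
  · intro a b hab
    have hpos : (m + 1 : ℝ) ≠ 0 := by positivity
    simpa [div_left_inj' hpos, Fin.ext_iff] using hab
  · intro j
    have hj := hm (j + 1) (by omega) (by omega)
    have hpos : (0 : ℝ) < m + 1 := by positivity
    have hlt : ((j + 1 : ℕ) : ℝ) < m + 1 := by exact_mod_cast Nat.succ_lt_succ j.2
    have hne0 : ((j + 1 : ℕ) : ℝ) / (m + 1) ≠ 0 := by positivity
    have hne1 : ((j + 1 : ℕ) : ℝ) / (m + 1) ≠ 1 := ((div_lt_one hpos).mpr hlt).ne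
    simpa [Polynomial.eval_mul, Polynomial.eval_pow, -Nat.cast_add, hne0,
      sub_ne_zero.mpr hne1] using hj
  · rw [Polynomial.natDegree_mul (left_ne_zero_of_mul hf) hg,
      Polynomial.natDegree_mul (pow_ne_zero _ (Polynomial.X_sub_C_ne_zero _))
        (pow_ne_zero _ (Polynomial.X_sub_C_ne_zero _))] at hdeg
    simp only [Polynomial.natDegree_pow, Polynomial.natDegree_X_sub_C] at hdeg
    simp only [Fintype.card_fin]
    omega

/-- Vanishing vertex, edge and normal derivative data along the line where variable `i` equals
`c` force divisibility by the square of `X i - C c`. -/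
theorem sq_X_sub_C_dvd {k : ℕ} (hk : 4 ≤ k) {p : Poly2} (hp : p.totalDegree ≤ k)
    {i j : Fin 2} (hij : j ≠ i) (c : ℝ)
    (h : ∀ t ∈ ({0, 1} : Set ℝ), (restrictLine i c p).eval t = 0 ∧
      (restrictLine i c (pderiv j p)).eval t = 0 ∧
      (restrictLine i c (pderiv i p)).eval t = 0 ∧
      (restrictLine i c (pderiv j (pderiv i p))).eval t = 0)
    (hedge : ∀ n : ℕ, 1 ≤ n → n ≤ k - 3 →
      (restrictLine i c p).eval ((n : ℝ) / ((k : ℝ) - 2)) = 0)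
    (hnormal : ∀ n : ℕ, 1 ≤ n → n ≤ k - 4 →
      (restrictLine i c (pderiv i p)).eval ((n : ℝ) / ((k : ℝ) - 3)) = 0) :
    (X i - C c) ^ 2 ∣ p := by
  obtain ⟨k, rfl⟩ := Nat.exists_eq_add_of_le' hk
  obtain ⟨a0, a1, a2, a3⟩ := h 0 (by simp)
  obtain ⟨b0, b1, b2, b3⟩ := h 1 (by simp)
  rw [← derivative_restrictLine hij] at a1 a3 b1 b3
  have hdvd : X i - C c ∣ p := by
    rw [X_sub_C_dvd_iff_restrictLine_eq_zero]
    refine eq_zero_of_double_zeros (m := k + 1) ?_ a0 a1 b0 b1 fun n hn hn' => ?_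
    · exact (natDegree_restrictLine_le i c p).trans hp
    · convert hedge n hn (by omega) using 3
      push_cast
      ring
  obtain ⟨q, rfl⟩ := hdvd
  obtain rfl | hq := eq_or_ne q 0
  · simp
  have hnorm : restrictLine i c (pderiv i ((X i - C c) * q)) = restrictLine i c q := by
    have hX : restrictLine i c (X i - C c) = 0 :=
      (X_sub_C_dvd_iff_restrictLine_eq_zero i c _).mp dvd_rfl
    simp [-map_sub, hX]
    simp
  rw [hnorm] at a2 a3 b2 b3 hnormal
  rw [totalDegree_mul_of_isDomain (X_sub_C_ne_zero i c) hq, totalDegree_X_sub_C] at hp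
  rw [pow_two]
  refine mul_dvd_mul_left _ ?_
  rw [X_sub_C_dvd_iff_restrictLine_eq_zero]
  refine eq_zero_of_double_zeros (m := k) ?_ a2 a3 b2 b3 fun n hn hn' => ?_
  · exact (natDegree_restrictLine_le i c q).trans (by omega)
  · convert hnormal n hn (by omega) using 3
    push_cast
    ring

/-- Unisolvence of a triangular grid of nodes: a polynomial of total degree less than `n`
vanishing at the `n (n + 1) / 2` nodes `(a i, a j)`, `s ≤ j ≤ i < s + n`, is zero. -/
theorem eq_zero_of_triangular_grid {a : ℕ → ℝ} (ha : Function.Injective a) (n s : ℕ) (q : Poly2)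
    (hq : q.totalDegree < n)
    (h : ∀ i j : ℕ, s ≤ j → j ≤ i → i < s + n → ev q (a i) (a j) = 0) : q = 0 := by
  induction n generalizing s q with
  | zero => omega
  | succ n ih =>
    have hdvd : X 1 - C (a s) ∣ q := by
      rw [X_sub_C_dvd_iff_restrictLine_eq_zero]
      refine Polynomial.eq_zero_of_natDegree_lt_card_of_eval_eq_zero _
        (f := fun i : Fin (n + 1) => a (s + i)) ?_ ?_ ?_
      · intro i j hij
        simpa [Fin.ext_iff] using ha hij
      · intro i
        rw [eval_restrictLine_one]
        exact h _ _ le_rfl (by omega) (by omega)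
      · simpa using (natDegree_restrictLine_le 1 (a s) q).trans_lt hq
    obtain ⟨r, rfl⟩ := hdvd
    obtain rfl | hr := eq_or_ne r 0
    · simp
    rw [totalDegree_mul_of_isDomain (X_sub_C_ne_zero _ _) hr, totalDegree_X_sub_C] at hq
    refine absurd (ih (s + 1) r (by omega) fun i j hj hji hi => ?_) hr
    have hne : a j - a s ≠ 0 := sub_ne_zero.mpr fun e => by have := ha e; omega
    simpa [ev, hne] using h i j (by omega) hji (by omega)

theorem pderiv_comm (i j : Fin 2) (p : Poly2) :
    pderiv i (pderiv j p) = pderiv j (pderiv i p) := by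
  have h : ⁅(pderiv i : Derivation ℝ Poly2 Poly2),
      (pderiv j : Derivation ℝ Poly2 Poly2)⁆ = 0 := by
    refine derivation_ext fun n => ?_
    simp [Derivation.commutator_apply, pderiv_X, Pi.single_apply, apply_ite]
  simpa [Derivation.commutator_apply, sub_eq_zero] using congrArg (fun D => D p) h

/-- a `P_k` polynomial (`k ≥ 6`) annihilated by all the degrees of freedom of
the bubble-enriched `C¹`-`P_k` element is zero. -/
theorem stmt_5
    (k : ℕ) (hk : 6 ≤ k)
    (p : Poly2) (hp : p.totalDegree ≤ k)
    (hvert : ∀ z ∈ ({(0, 0), (1, 0), (1, 1), (0, 1)} : Set (ℝ × ℝ)),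
      ev p z.1 z.2 = 0 ∧ ev (dX p) z.1 z.2 = 0 ∧ ev (dY p) z.1 z.2 = 0 ∧
        ev (dX (dY p)) z.1 z.2 = 0)
    (hedge : ∀ j : ℕ, 1 ≤ j → j ≤ k - 3 →
      ev p ((j : ℝ) / ((k : ℝ) - 2)) 0 = 0 ∧ ev p ((j : ℝ) / ((k : ℝ) - 2)) 1 = 0 ∧
      ev p 0 ((j : ℝ) / ((k : ℝ) - 2)) = 0 ∧ ev p 1 ((j : ℝ) / ((k : ℝ) - 2)) = 0)
    (hnormal : ∀ j : ℕ, 1 ≤ j → j ≤ k - 4 →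
      ev (dY p) ((j : ℝ) / ((k : ℝ) - 3)) 0 = 0 ∧ ev (dY p) ((j : ℝ) / ((k : ℝ) - 3)) 1 = 0 ∧
      ev (dX p) 0 ((j : ℝ) / ((k : ℝ) - 3)) = 0 ∧ ev (dX p) 1 ((j : ℝ) / ((k : ℝ) - 3)) = 0)
    (hint : ∀ i j : ℕ, 1 ≤ j → j ≤ i → i ≤ k - 7 →
      ev p ((i : ℝ) / ((k : ℝ) - 2)) ((j : ℝ) / ((k : ℝ) - 2)) = 0) :
    p = 0 := by
  have hvertex (a b : ℝ) (ha : a = 0 ∨ a = 1) (hb : b = 0 ∨ b = 1) :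
      ev p a b = 0 ∧ ev (dX p) a b = 0 ∧ ev (dY p) a b = 0 ∧ ev (dX (dY p)) a b = 0 :=
    hvert (a, b) (by rcases ha with rfl | rfl <;> rcases hb with rfl | rfl <;> simp)
  have hx (c : ℝ) (hc : c = 0 ∨ c = 1) : (X 0 - C c) ^ 2 ∣ p := by
    refine sq_X_sub_C_dvd (j := 1) (by omega) hp (by decide) c ?_ ?_ ?_ <;>
      simp only [eval_restrictLine_zero]
    · intro t ht
      obtain ⟨h, hX, hY, hXY⟩ := hvertex c t hc ht
      exact ⟨h, hY, hX, pderiv_comm 1 0 p ▸ hXY⟩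
    · intro n h1 h2
      rcases hc with rfl | rfl
      exacts [(hedge n h1 h2).2.2.1, (hedge n h1 h2).2.2.2]
    · intro n h1 h2
      rcases hc with rfl | rfl
      exacts [(hnormal n h1 h2).2.2.1, (hnormal n h1 h2).2.2.2]
  have hy (c : ℝ) (hc : c = 0 ∨ c = 1) : (X 1 - C c) ^ 2 ∣ p := by
    refine sq_X_sub_C_dvd (j := 0) (by omega) hp (by decide) c ?_ ?_ ?_ <;>
      simp only [eval_restrictLine_one]
    · intro t ht
      obtain ⟨h, hX, hY, hXY⟩ := hvertex t c ht hc
      exact ⟨h, hX, hY, hXY⟩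
    · intro n h1 h2
      rcases hc with rfl | rfl
      exacts [(hedge n h1 h2).1, (hedge n h1 h2).2.1]
    · intro n h1 h2
      rcases hc with rfl | rfl
      exacts [(hnormal n h1 h2).1, (hnormal n h1 h2).2.1]
  have hx0 := hx 0 (.inl rfl)
  have hx1 := hx 1 (.inr rfl)
  have hy0 := hy 0 (.inl rfl)
  have hy1 := hy 1 (.inr rfl)
  clear hx hy hvertex hvert hedge hnormal
  obtain ⟨q, rfl⟩ := hx0
  obtain ⟨q, rfl⟩ := (prime_X_sub_C 0 1).pow_dvd_of_dvd_mul_left 2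
    (not_X_sub_C_dvd_pow (by norm_num) 2) hx1
  replace hy0 := (prime_X_sub_C 1 0).pow_dvd_of_dvd_mul_left 2
    (not_X_sub_C_dvd_pow (by norm_num) 2) hy0
  obtain ⟨q, rfl⟩ := (prime_X_sub_C 1 0).pow_dvd_of_dvd_mul_left 2
    (not_X_sub_C_dvd_pow (by norm_num) 2) hy0
  replace hy1 := (prime_X_sub_C 1 1).pow_dvd_of_dvd_mul_left 2
    (not_X_sub_C_dvd_pow (by norm_num) 2) hy1
  replace hy1 := (prime_X_sub_C 1 1).pow_dvd_of_dvd_mul_left 2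
    (not_X_sub_C_dvd_pow (by norm_num) 2) hy1
  obtain ⟨q, rfl⟩ := (prime_X_sub_C 1 1).pow_dvd_of_dvd_mul_left 2
    (not_X_sub_C_dvd_pow (by norm_num) 2) hy1
  by_contra hne
  have hq : q ≠ 0 := by
    rintro rfl
    simp at hne
  have hne1 := right_ne_zero_of_mul hne
  have hne2 := right_ne_zero_of_mul hne1
  have hne3 := right_ne_zero_of_mul hne2
  rw [totalDegree_X_sub_C_sq_mul _ _ hne1, totalDegree_X_sub_C_sq_mul _ _ hne2,
    totalDegree_X_sub_C_sq_mul _ _ hne3, totalDegree_X_sub_C_sq_mul _ _ hq] at hp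
  have hk8 : (8 : ℝ) ≤ k := by exact_mod_cast (by omega : 8 ≤ k)
  have hpos : (0 : ℝ) < (k : ℝ) - 2 := by linarith
  refine hq (eq_zero_of_triangular_grid (a := fun n : ℕ => (n : ℝ) / ((k : ℝ) - 2)) ?_
    (k - 7) 1 q (by omega) fun i j hj hji hi => ?_)
  · intro m n hmn
    exact_mod_cast (div_left_inj' hpos.ne').mp hmn
  · have hnode (n : ℕ) (h1 : 1 ≤ n) (h2 : n ≤ k - 7) :
        (n : ℝ) / ((k : ℝ) - 2) ≠ 0 ∧ (n : ℝ) / ((k : ℝ) - 2) - 1 ≠ 0 := by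
      have hn : (0 : ℝ) < n := by exact_mod_cast h1
      have hn' : (n : ℝ) + 7 ≤ k := by exact_mod_cast (by omega : n + 7 ≤ k)
      exact ⟨(div_pos hn hpos).ne',
        sub_ne_zero.mpr ((div_lt_one hpos).mpr (by linarith)).ne⟩
    obtain ⟨hi0, hi1⟩ := hnode i (by omega) (by omega)
    obtain ⟨hj0, hj1⟩ := hnode j hj (by omega)
    have h := hint i j hj hji (by omega)
    simp only [ev] at h ⊢
    simp only [map_mul, map_pow, map_sub, eval_X, eval_C, Matrix.cons_val_zero,
      Matrix.cons_val_one, sub_zero, mul_eq_zero, pow_eq_zero_iff two_ne_zero, hi0, hi1, hj0, hj1,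
      false_or] at h
    exact h
end
end

section
/- Let k ≥ 4 and let v be a real polynomial in x, y of degree at most k in x and at most k in y separately, such that the univariate polynomial y ↦ ∂_x v(0,y) has degree at most k−1. Suppose v = ∂_x v = ∂_y v = ∂_{xy} v = 0 at the two points (0,0) and (0,1), v(0, j/(k−2)) = 0 for j = 1,…,k−3, and ∂_x v(0, j/(k−3)) = 0 for j = 1,…,k−4. Then v(0,y) = 0 and ∂_x v(0,y) = 0 for all y; that is, both the trace and the normal-derivative trace of v on the edge x = 0 vanish identically. -/
open MvPolynomial

noncomputable section

/-- Restriction of `p` to the vertical line `x = c`, as a univariate polynomial in `y`. -/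
def lineX (c : ℝ) (p : Poly2) : Polynomial ℝ :=
  MvPolynomial.aeval (fun i : Fin 2 => if i = 0 then Polynomial.C c else Polynomial.X) p

lemma eval_lineX (c y : ℝ) (p : Poly2) : (lineX c p).eval y = ev p c y := by
  have h : (Polynomial.evalRingHom y).comp
      (MvPolynomial.aeval (R := ℝ) (fun i : Fin 2 =>
        if i = 0 then Polynomial.C c else Polynomial.X)).toRingHom =
      MvPolynomial.eval ![c, y] := by
    apply MvPolynomial.ringHom_ext
    · intro r
      simp
    · intro i
      fin_cases i <;> simp
  exact RingHom.congr_fun h p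

lemma derivative_lineX (c : ℝ) (p : Poly2) :
    Polynomial.derivative (lineX c p) = lineX c (dY p) := by
  unfold lineX dY
  induction p using MvPolynomial.induction_on with
  | C a => simp
  | add p q hp hq => simp [hp, hq]
  | mul_X p i hp =>
    fin_cases i <;>
      simp [hp, Derivation.leibniz, MvPolynomial.pderiv_X, mul_comm]

lemma natDegree_lineX_le (c : ℝ) (p : Poly2) :
    (lineX c p).natDegree ≤ p.degreeOf 1 := by
  unfold lineX
  rw [MvPolynomial.aeval_def, MvPolynomial.eval₂_eq']
  refine Polynomial.natDegree_sum_le_of_forall_le _ _ fun s hs => ?_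
  have h : s 1 ≤ p.degreeOf 1 := MvPolynomial.le_degreeOf_of_mem_support 1 hs
  refine le_trans ?_ h
  simp only [Fin.prod_univ_two, Polynomial.algebraMap_apply, Algebra.algebraMap_self,
    RingHom.id_apply, if_true, one_ne_zero, if_false, ← Polynomial.C_pow, ← mul_assoc,
    ← Polynomial.C_mul]
  exact Polynomial.natDegree_C_mul_X_pow_le _ _

lemma dX_dY_comm (p : Poly2) : dX (dY p) = dY (dX p) := by
  unfold dX dY
  induction p using MvPolynomial.induction_on with
  | C a => simp
  | add p q hp hq => simp [hp, hq]
  | mul_X p i hp =>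
    fin_cases i <;>
      simp [hp, Derivation.leibniz, MvPolynomial.pderiv_X, add_comm]

/-- A polynomial of degree at most `m + 3` with double zeros at `0` and `1` that also vanishes at
the `m` equispaced interior points of `[0, 1]` is zero. -/
lemma eq_zero_of_hermite_equispaced (m : ℕ) (p : Polynomial ℝ) (hdeg : p.natDegree ≤ m + 3)
    (h0 : p.eval 0 = 0) (h1 : p.eval 1 = 0)
    (h0' : (Polynomial.derivative p).eval 0 = 0) (h1' : (Polynomial.derivative p).eval 1 = 0)
    (h : ∀ j : ℕ, 1 ≤ j → j ≤ m → p.eval ((j : ℝ) / ((m : ℝ) + 1)) = 0) : p = 0 := by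
  by_contra hp
  have hm : (m : ℝ) + 1 ≠ 0 := by positivity
  let f : ℕ → ℝ := fun j => (j : ℝ) / ((m : ℝ) + 1)
  have hf : Function.Injective f := fun a b hab => by
    have : (a : ℝ) = b := (div_left_inj' hm).1 hab
    exact_mod_cast this
  have f0 : f 0 = 0 := by simp [f]
  have f1 : f (m + 1) = 1 := by simp [f, div_self hm]
  have hroot : ∀ j ∈ Finset.range (m + 2), p.eval (f j) = 0 := by
    intro j hj
    rw [Finset.mem_range] at hj
    rcases Nat.eq_zero_or_pos j with rfl | hj0
    · rw [f0, h0]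
    rcases Nat.lt_or_ge m j with hjm | hjm
    · obtain rfl : j = m + 1 := by omega
      rw [f1, h1]
    · exact h j hj0 hjm
  have hsub : (Finset.range (m + 2)).image f ⊆ p.roots.toFinset := by
    intro a ha
    obtain ⟨j, hj, rfl⟩ := Finset.mem_image.1 ha
    rw [Multiset.mem_toFinset, Polynomial.mem_roots hp]
    exact hroot j hj
  have hle : ∑ j ∈ Finset.range (m + 2), p.roots.count (f j) ≤ m + 3 := by
    rw [← Finset.sum_image (f := fun a => p.roots.count a) (fun a _ b _ hab => hf hab)]
    calc _ ≤ ∑ a ∈ p.roots.toFinset, p.roots.count a := Finset.sum_le_sum_of_subset hsub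
      _ = p.roots.card := Multiset.toFinset_sum_count_eq _
      _ ≤ m + 3 := (Polynomial.card_roots' p).trans hdeg
  have c0 : 1 < p.roots.count (f 0) := by
    rw [f0, Polynomial.count_roots, Polynomial.one_lt_rootMultiplicity_iff_isRoot hp]
    exact ⟨h0, h0'⟩
  have c1 : 1 < p.roots.count (f (m + 1)) := by
    rw [f1, Polynomial.count_roots, Polynomial.one_lt_rootMultiplicity_iff_isRoot hp]
    exact ⟨h1, h1'⟩
  have hmid : ∑ j ∈ Finset.range m, 1 ≤ ∑ j ∈ Finset.range m, p.roots.count (f (j + 1)) := by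
    refine Finset.sum_le_sum fun j hj => ?_
    rw [Multiset.one_le_count_iff_mem, Polynomial.mem_roots hp]
    exact hroot _ (by rw [Finset.mem_range] at hj ⊢; omega)
  rw [Finset.sum_range_succ, Finset.sum_range_succ'] at hle
  simp only [Finset.sum_const, Finset.card_range, smul_eq_mul, mul_one] at hmid
  omega

/-- for `v ∈ Q_k` whose normal derivative on the edge `x = 0` has degree at
most `k - 1`, the vanishing of the degrees of freedom associated with that edge forces the
trace and normal-derivative trace of `v` on the edge `x = 0` to vanish identically. -/
theorem stmt_10
    (k : ℕ) (hk : 4 ≤ k)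
    (v : Poly2) (hQx : v.degreeOf 0 ≤ k) (hQy : v.degreeOf 1 ≤ k)
    (hdeg : (lineX 0 (dX v)).natDegree ≤ k - 1)
    (hvert : ∀ z ∈ ({(0, 0), (0, 1)} : Set (ℝ × ℝ)),
      ev v z.1 z.2 = 0 ∧ ev (dX v) z.1 z.2 = 0 ∧ ev (dY v) z.1 z.2 = 0 ∧
        ev (dX (dY v)) z.1 z.2 = 0)
    (hedge : ∀ j : ℕ, 1 ≤ j → j ≤ k - 3 → ev v 0 ((j : ℝ) / ((k : ℝ) - 2)) = 0)
    (hnormal : ∀ j : ℕ, 1 ≤ j → j ≤ k - 4 → ev (dX v) 0 ((j : ℝ) / ((k : ℝ) - 3)) = 0) :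
    ∀ y : ℝ, ev v 0 y = 0 ∧ ev (dX v) 0 y = 0 := by
  obtain ⟨a0, b0, c0, d0⟩ := hvert (0, 0) (by simp)
  obtain ⟨a1, b1, c1, d1⟩ := hvert (0, 1) (by simp)
  have hv : lineX 0 v = 0 := by
    refine eq_zero_of_hermite_equispaced (k - 3) _
      ((natDegree_lineX_le 0 v).trans (by omega)) ?_ ?_ ?_ ?_ fun j hj hjk => ?_
    · rw [eval_lineX]; exact a0
    · rw [eval_lineX]; exact a1
    · rw [derivative_lineX, eval_lineX]; exact c0
    · rw [derivative_lineX, eval_lineX]; exact c1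
    · have hcast : ((k - 3 : ℕ) : ℝ) + 1 = (k : ℝ) - 2 := by
        rw [Nat.cast_sub (by omega)]; push_cast; ring
      rw [eval_lineX, hcast]
      exact hedge j hj hjk
  have hn : lineX 0 (dX v) = 0 := by
    refine eq_zero_of_hermite_equispaced (k - 4) _
      (hdeg.trans (by omega)) ?_ ?_ ?_ ?_ fun j hj hjk => ?_
    · rw [eval_lineX]; exact b0
    · rw [eval_lineX]; exact b1
    · rw [derivative_lineX, ← dX_dY_comm, eval_lineX]; exact d0
    · rw [derivative_lineX, ← dX_dY_comm, eval_lineX]; exact d1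
    · have hcast : ((k - 4 : ℕ) : ℝ) + 1 = (k : ℝ) - 3 := by
        rw [Nat.cast_sub hk]; push_cast; ring
      rw [eval_lineX, hcast]
      exact hnormal j hj hjk
  intro y
  rw [← eval_lineX, ← eval_lineX, hv, hn]
  simp
end
end

section
/- Let b1,…,b5 be functions in the Bell space W_4(T) satisfying the dual-basis conditions: every Bell degree-of-freedom functional (for k=4) vanishes on each b_i, except that b1(1/2,0)=1, b2(1,0)=1, ∂_x b3(1,0)=1, ∂_y b4(1,0)=1, ∂_{xy} b5(1,0)=1, each b_i taking value 1 only at its own designated functional and 0 at all other Bell functionals. Then P_4 ∩ span{b1,…,b5} = {0}, i.e. if p + c1·b1 + … + c5·b5 = 0 with p ∈ P_4 and real c_i, then p = 0 and all c_i = 0; consequently the space V_4(T) = P_4 + span{b1,…,b5} has dimension 20. -/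
open MvPolynomial

noncomputable section

/-- Restriction of `p` to the horizontal line `y = c`, as a univariate polynomial in `x`. -/
def lineY (c : ℝ) (p : Poly2) : Polynomial ℝ :=
  MvPolynomial.aeval (fun i : Fin 2 => if i = 0 then Polynomial.X else Polynomial.C c) p

/-- The Bell space `W_k(T)` on the unit square: `v ∈ Q_k` such that on each edge the
normal derivative has degree at most `k - 1` in the edge variable. -/
def BellSpace (k : ℕ) (v : Poly2) : Prop :=
  v.degreeOf 0 ≤ k ∧ v.degreeOf 1 ≤ k ∧
  (lineX 0 (dX v)).natDegree ≤ k - 1 ∧ (lineX 1 (dX v)).natDegree ≤ k - 1 ∧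
  (lineY 0 (dY v)).natDegree ≤ k - 1 ∧ (lineY 1 (dY v)).natDegree ≤ k - 1

/-- The set of Bell degree-of-freedom functionals on the unit square, for degree `k`. -/
def BellDofs (k : ℕ) : Set (Poly2 → ℝ) :=
  { F | (∃ i j : ℕ, i ≤ k - 2 ∧ j ≤ k - 2 ∧
          F = fun v => ev v ((i : ℝ) / ((k : ℝ) - 2)) ((j : ℝ) / ((k : ℝ) - 2))) ∨
        (∃ i j : ℕ, i ≤ 1 ∧ j ≤ k - 3 ∧
          F = fun v => ev (dX v) (i : ℝ) ((j : ℝ) / ((k : ℝ) - 3))) ∨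
        (∃ i j : ℕ, i ≤ k - 3 ∧ j ≤ 1 ∧
          F = fun v => ev (dY v) ((i : ℝ) / ((k : ℝ) - 3)) (j : ℝ)) ∨
        (∃ i j : ℕ, i ≤ 1 ∧ j ≤ 1 ∧
          F = fun v => ev (dX (dY v)) (i : ℝ) (j : ℝ)) }

/-- `b` is the Bell nodal basis function dual to the degree-of-freedom functional `F0`:
`F0 b = 1` and every other Bell degree-of-freedom functional vanishes on `b`. -/
def IsDualTo (k : ℕ) (F0 : Poly2 → ℝ) (b : Poly2) : Prop :=
  F0 b = 1 ∧ ∀ F ∈ BellDofs k, F ≠ F0 → F b = 0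

/-- Evaluation at `(x, y)` as a linear functional. -/
def evalL (x y : ℝ) : Poly2 →ₗ[ℝ] ℝ := (MvPolynomial.aeval ![x, y]).toLinearMap

/-- Evaluation of `∂ₓ` at `(x, y)` as a linear functional. -/
def evalDX (x y : ℝ) : Poly2 →ₗ[ℝ] ℝ := evalL x y ∘ₗ (MvPolynomial.pderiv 0).toLinearMap

/-- Evaluation of `∂_y` at `(x, y)` as a linear functional. -/
def evalDY (x y : ℝ) : Poly2 →ₗ[ℝ] ℝ := evalL x y ∘ₗ (MvPolynomial.pderiv 1).toLinearMap

/-- Evaluation of `∂ₓ∂_y` at `(x, y)` as a linear functional. -/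
def evalDXY (x y : ℝ) : Poly2 →ₗ[ℝ] ℝ := evalDX x y ∘ₗ (MvPolynomial.pderiv 1).toLinearMap

lemma coe_evalL (x y : ℝ) : ⇑(evalL x y) = fun v => ev v x y := rfl

lemma coe_evalDX (x y : ℝ) : ⇑(evalDX x y) = fun v => ev (dX v) x y := rfl

lemma coe_evalDY (x y : ℝ) : ⇑(evalDY x y) = fun v => ev (dY v) x y := rfl

lemma coe_evalDXY (x y : ℝ) : ⇑(evalDXY x y) = fun v => ev (dX (dY v)) x y := rfl

/-- The monomial `x ^ i * y ^ j`. -/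
def mono (i j : ℕ) : Poly2 := X 0 ^ i * X 1 ^ j

lemma pderiv_zero_mono (i j : ℕ) : pderiv 0 (mono i j) = (i : ℝ) • mono (i - 1) j := by
  simp [mono, Derivation.leibniz, Derivation.leibniz_pow, pderiv_X, MvPolynomial.smul_eq_C_mul]
  ring

lemma pderiv_one_mono (i j : ℕ) : pderiv 1 (mono i j) = (j : ℝ) • mono i (j - 1) := by
  simp [mono, Derivation.leibniz, Derivation.leibniz_pow, pderiv_X, MvPolynomial.smul_eq_C_mul]
  ring

lemma evalL_mono (x y : ℝ) (i j : ℕ) : evalL x y (mono i j) = x ^ i * y ^ j := by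
  simp [evalL, mono]

lemma evalDX_mono (x y : ℝ) (i j : ℕ) :
    evalDX x y (mono i j) = i * (x ^ (i - 1) * y ^ j) := by
  simp [evalDX, pderiv_zero_mono, evalL_mono]

lemma evalDY_mono (x y : ℝ) (i j : ℕ) :
    evalDY x y (mono i j) = j * (x ^ i * y ^ (j - 1)) := by
  simp [evalDY, pderiv_one_mono, evalL_mono]

lemma evalDXY_mono (x y : ℝ) (i j : ℕ) :
    evalDXY x y (mono i j) = j * (i * (x ^ (i - 1) * y ^ (j - 1))) := by
  simp [evalDXY, pderiv_one_mono, evalDX_mono]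

/-- Pairs of exponents of total degree at most `n`. -/
def degreePairs (n : ℕ) : Finset (ℕ × ℕ) :=
  (Finset.range (n + 1) ×ˢ Finset.range (n + 1)).filter fun d => d.1 + d.2 ≤ n

lemma mem_degreePairs {n : ℕ} {d : ℕ × ℕ} : d ∈ degreePairs n ↔ d.1 + d.2 ≤ n := by
  simp only [degreePairs, Finset.mem_filter, Finset.mem_product, Finset.mem_range]
  omega

lemma sum_finTwo (d : Fin 2 →₀ ℕ) : (d.sum fun _ e => e) = d 0 + d 1 := by
  simp [Finsupp.sum_fintype]

lemma exists_eq_sum_mono {n : ℕ} {p : Poly2} (hp : p.totalDegree ≤ n) :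
    ∃ a : ℕ × ℕ → ℝ, p = ∑ d ∈ degreePairs n, a d • mono d.1 d.2 := by
  refine ⟨fun d => p.coeff ((finTwoArrowEquiv' ℕ).symm d), ?_⟩
  have hsub : p.support ⊆ (degreePairs n).map (finTwoArrowEquiv' ℕ).symm.toEmbedding := by
    intro d hd
    refine Finset.mem_map.mpr ⟨finTwoArrowEquiv' ℕ d, mem_degreePairs.mpr ?_,
      Equiv.symm_apply_apply _ d⟩
    have h := (le_totalDegree hd).trans hp
    rw [sum_finTwo] at h
    simpa [finTwoArrowEquiv'] using h
  conv_lhs => rw [p.as_sum]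
  rw [Finset.sum_subset hsub fun d _ hd => by simp [notMem_support_iff.mp hd], Finset.sum_map]
  refine Finset.sum_congr rfl fun d _ => ?_
  simp [monomial_fin_two, mono, finTwoArrowEquiv', smul_eq_C_mul, mul_assoc]

lemma finrank_restrictTotalDegree_two (n : ℕ) :
    Module.finrank ℝ (restrictTotalDegree (Fin 2) ℝ n) = (degreePairs n).card := by
  rw [restrictTotalDegree, Module.finrank_eq_nat_card_basis (basisRestrictSupport ℝ _),
    ← Nat.card_eq_finsetCard]
  refine Nat.card_congr ((finTwoArrowEquiv' ℕ).subtypeEquiv fun d => ?_)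
  rw [mem_degreePairs, Set.mem_ofPred_eq, sum_finTwo]
  simp [finTwoArrowEquiv']

/-- Unisolvence on `P₄` of fifteen of the Bell degrees of freedom. -/
lemma eq_zero_of_bellDofs {p : Poly2} (hp : p.totalDegree ≤ 4)
    (h00 : evalL 0 0 p = 0) (h01 : evalL 0 (1 / 2) p = 0) (h02 : evalL 0 1 p = 0)
    (h12 : evalL (1 / 2) 1 p = 0) (h21 : evalL 1 (1 / 2) p = 0) (h22 : evalL 1 1 p = 0)
    (hx00 : evalDX 0 0 p = 0) (hx01 : evalDX 0 1 p = 0) (hx11 : evalDX 1 1 p = 0)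
    (hy00 : evalDY 0 0 p = 0) (hy01 : evalDY 0 1 p = 0) (hy11 : evalDY 1 1 p = 0)
    (hxy00 : evalDXY 0 0 p = 0) (hxy01 : evalDXY 0 1 p = 0) (hxy11 : evalDXY 1 1 p = 0) :
    p = 0 := by
  obtain ⟨a, rfl⟩ := exists_eq_sum_mono hp
  have hT : degreePairs 4 = {(0, 0), (0, 1), (0, 2), (0, 3), (0, 4), (1, 0), (1, 1), (1, 2),
      (1, 3), (2, 0), (2, 1), (2, 2), (3, 0), (3, 1), (4, 0)} := by decide
  simp [hT, evalL_mono, evalDX_mono, evalDY_mono, evalDXY_mono] at *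
  have e00 : a (0, 0) = 0 := by linarith
  have e01 : a (0, 1) = 0 := by linarith
  have e02 : a (0, 2) = 0 := by linarith
  have e03 : a (0, 3) = 0 := by linarith
  have e04 : a (0, 4) = 0 := by linarith
  have e10 : a (1, 0) = 0 := by linarith
  have e11 : a (1, 1) = 0 := by linarith
  have e12 : a (1, 2) = 0 := by linarith
  have e13 : a (1, 3) = 0 := by linarith
  have e20 : a (2, 0) = 0 := by linarith
  have e21 : a (2, 1) = 0 := by linarith
  have e22 : a (2, 2) = 0 := by linarith
  have e30 : a (3, 0) = 0 := by linarith
  have e31 : a (3, 1) = 0 := by linarith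
  have e40 : a (4, 0) = 0 := by linarith
  simp [*]

/-- The functionals to which `b₁,…,b₅` are dual. -/
def dualDof : Fin 5 → Poly2 →ₗ[ℝ] ℝ :=
  ![evalL (1 / 2) 0, evalL 1 0, evalDX 1 0, evalDY 1 0, evalDXY 1 0]

/-- A polynomial on which each functional `dualDof i` differs from all other Bell degrees of
freedom for `k = 4`. -/
def separator : Poly2 := mono 2 0 + (3 : ℝ) • mono 1 2 - mono 2 1

lemma dualDof_separator (i : Fin 5) : dualDof i separator = ![1 / 4, 1, 2, -1, -2] i := by
  fin_cases i <;>
    norm_num [dualDof, separator, evalL_mono, evalDX_mono, evalDY_mono, evalDXY_mono]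

lemma dualDof_separator_injective : Function.Injective fun i => dualDof i separator := by
  intro i j h
  simp only [dualDof_separator] at h
  fin_cases i <;> fin_cases j <;> first | rfl | (norm_num at h)

lemma dualDof_separator_mem (i : Fin 5) :
    dualDof i separator ∈ ({1 / 4, 1, 2, -1, -2} : Set ℝ) := by
  rw [dualDof_separator]
  fin_cases i <;> simp

lemma evalL_mem_bellDofs {i j : ℕ} (hi : i ≤ 2) (hj : j ≤ 2) :
    ⇑(evalL (i / 2) (j / 2)) ∈ BellDofs 4 :=
  Or.inl ⟨i, j, hi, hj, by rw [coe_evalL]; norm_num⟩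

lemma evalDX_mem_bellDofs {i j : ℕ} (hi : i ≤ 1) (hj : j ≤ 1) :
    ⇑(evalDX i j) ∈ BellDofs 4 :=
  Or.inr <| Or.inl ⟨i, j, hi, hj, by rw [coe_evalDX]; norm_num⟩

lemma evalDY_mem_bellDofs {i j : ℕ} (hi : i ≤ 1) (hj : j ≤ 1) :
    ⇑(evalDY i j) ∈ BellDofs 4 :=
  Or.inr <| Or.inr <| Or.inl ⟨i, j, hi, hj, by rw [coe_evalDY]; norm_num⟩

lemma evalDXY_mem_bellDofs {i j : ℕ} (hi : i ≤ 1) (hj : j ≤ 1) :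
    ⇑(evalDXY i j) ∈ BellDofs 4 :=
  Or.inr <| Or.inr <| Or.inr ⟨i, j, hi, hj, coe_evalDXY _ _⟩

lemma dualDof_mem_bellDofs (i : Fin 5) : ⇑(dualDof i) ∈ BellDofs 4 := by
  fin_cases i
  · simpa [dualDof] using evalL_mem_bellDofs (i := 1) (j := 0) (by norm_num) (by norm_num)
  · simpa [dualDof] using evalL_mem_bellDofs (i := 2) (j := 0) (by norm_num) (by norm_num)
  · simpa [dualDof] using evalDX_mem_bellDofs (i := 1) (j := 0) (by norm_num) (by norm_num)
  · simpa [dualDof] using evalDY_mem_bellDofs (i := 1) (j := 0) (by norm_num) (by norm_num)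
  · simpa [dualDof] using evalDXY_mem_bellDofs (i := 1) (j := 0) (by norm_num) (by norm_num)

lemma dualDof_apply {b : Fin 5 → Poly2} (hb : ∀ i, IsDualTo 4 (dualDof i) (b i))
    (i j : Fin 5) : dualDof i (b j) = if i = j then 1 else 0 := by
  split_ifs with h
  · exact h ▸ (hb i).1
  · exact (hb j).2 _ (dualDof_mem_bellDofs i) fun e =>
      h (dualDof_separator_injective (congrFun e separator))

lemma dof_apply_eq_zero {b : Fin 5 → Poly2} (hb : ∀ i, IsDualTo 4 (dualDof i) (b i))
    {F : Poly2 →ₗ[ℝ] ℝ} (hF : ⇑F ∈ BellDofs 4)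
    (hs : F separator ∉ ({1 / 4, 1, 2, -1, -2} : Set ℝ))
    {p : Poly2} {c : Fin 5 → ℝ} (h : p + ∑ i, c i • b i = 0) : F p = 0 := by
  have hFb : ∀ i, F (b i) = 0 := fun i =>
    (hb i).2 _ hF fun e => hs (congrFun e separator ▸ dualDof_separator_mem i)
  simpa [hFb] using congrArg F h

lemma linearIndependent_of_dual {b : Fin 5 → Poly2} (hb : ∀ i, IsDualTo 4 (dualDof i) (b i)) :
    LinearIndependent ℝ b := by
  rw [Fintype.linearIndependent_iff]
  intro c hc i
  simpa [dualDof_apply hb] using congrArg (dualDof i) hc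

lemma eq_zero_of_add_sum_eq_zero {b : Fin 5 → Poly2} (hb : ∀ i, IsDualTo 4 (dualDof i) (b i))
    {p : Poly2} (hp : p.totalDegree ≤ 4) {c : Fin 5 → ℝ}
    (h : p + ∑ i, c i • b i = 0) : p = 0 := by
  have hL (i j : ℕ) (hi : i ≤ 2) (hj : j ≤ 2)
      (hs : evalL (i / 2) (j / 2) separator ∉ ({1 / 4, 1, 2, -1, -2} : Set ℝ)) :
      evalL (i / 2) (j / 2) p = 0 := dof_apply_eq_zero hb (evalL_mem_bellDofs hi hj) hs h
  have hX (i j : ℕ) (hi : i ≤ 1) (hj : j ≤ 1)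
      (hs : evalDX i j separator ∉ ({1 / 4, 1, 2, -1, -2} : Set ℝ)) :
      evalDX i j p = 0 := dof_apply_eq_zero hb (evalDX_mem_bellDofs hi hj) hs h
  have hY (i j : ℕ) (hi : i ≤ 1) (hj : j ≤ 1)
      (hs : evalDY i j separator ∉ ({1 / 4, 1, 2, -1, -2} : Set ℝ)) :
      evalDY i j p = 0 := dof_apply_eq_zero hb (evalDY_mem_bellDofs hi hj) hs h
  have hXY (i j : ℕ) (hi : i ≤ 1) (hj : j ≤ 1)
      (hs : evalDXY i j separator ∉ ({1 / 4, 1, 2, -1, -2} : Set ℝ)) :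
      evalDXY i j p = 0 := dof_apply_eq_zero hb (evalDXY_mem_bellDofs hi hj) hs h
  simp only [separator, map_add, map_sub, map_smul, evalL_mono, evalDX_mono, evalDY_mono,
    evalDXY_mono, smul_eq_mul] at hL hX hY hXY
  apply eq_zero_of_bellDofs hp
  · simpa using hL 0 0 (by norm_num) (by norm_num) (by norm_num)
  · simpa using hL 0 1 (by norm_num) (by norm_num) (by norm_num)
  · simpa using hL 0 2 (by norm_num) (by norm_num) (by norm_num)
  · simpa using hL 1 2 (by norm_num) (by norm_num) (by norm_num)
  · simpa using hL 2 1 (by norm_num) (by norm_num) (by norm_num)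
  · simpa using hL 2 2 (by norm_num) (by norm_num) (by norm_num)
  · simpa using hX 0 0 (by norm_num) (by norm_num) (by norm_num)
  · simpa using hX 0 1 (by norm_num) (by norm_num) (by norm_num)
  · simpa using hX 1 1 (by norm_num) (by norm_num) (by norm_num)
  · simpa using hY 0 0 (by norm_num) (by norm_num) (by norm_num)
  · simpa using hY 0 1 (by norm_num) (by norm_num) (by norm_num)
  · simpa using hY 1 1 (by norm_num) (by norm_num) (by norm_num)
  · simpa using hXY 0 0 (by norm_num) (by norm_num) (by norm_num)
  · simpa using hXY 0 1 (by norm_num) (by norm_num) (by norm_num)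
  · simpa using hXY 1 1 (by norm_num) (by norm_num) (by norm_num)

lemma disjoint_restrictTotalDegree_span
    {b : Fin 5 → Poly2} (hb : ∀ i, IsDualTo 4 (dualDof i) (b i)) :
    Disjoint (restrictTotalDegree (Fin 2) ℝ 4) (Submodule.span ℝ (Set.range b)) := by
  rw [Submodule.disjoint_def]
  intro p hp hpb
  obtain ⟨c, rfl⟩ := (Submodule.mem_span_range_iff_exists_fun ℝ).mp hpb
  refine eq_zero_of_add_sum_eq_zero hb ((mem_restrictTotalDegree ..).mp hp) (c := -c) ?_
  simp

/-- `P₄ ∩ span{b₁,…,b₅} = {0}`, and the bubble-enriched space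
`V₄(T) = P₄ + span{b₁,…,b₅}` has dimension `20`. -/
theorem stmt_13
    (b : Fin 5 → Poly2)
    (hW : ∀ i, BellSpace 4 (b i))
    (hb1 : IsDualTo 4 (fun v => ev v (1 / 2) 0) (b 0))
    (hb2 : IsDualTo 4 (fun v => ev v 1 0) (b 1))
    (hb3 : IsDualTo 4 (fun v => ev (dX v) 1 0) (b 2))
    (hb4 : IsDualTo 4 (fun v => ev (dY v) 1 0) (b 3))
    (hb5 : IsDualTo 4 (fun v => ev (dX (dY v)) 1 0) (b 4)) :
    (∀ (p : Poly2), p.totalDegree ≤ 4 → ∀ c : Fin 5 → ℝ,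
      p + ∑ i, c i • b i = 0 → p = 0 ∧ ∀ i, c i = 0) ∧
    Module.finrank ℝ
      ↥(MvPolynomial.restrictTotalDegree (Fin 2) ℝ 4 ⊔
          Submodule.span ℝ (Set.range b)) = 20 := by
  have hb : ∀ i, IsDualTo 4 (dualDof i) (b i) := by
    intro i
    fin_cases i
    exacts [hb1, hb2, hb3, hb4, hb5]
  have hli := linearIndependent_of_dual hb
  refine ⟨fun p hp c h => ?_, ?_⟩
  · have hp0 := eq_zero_of_add_sum_eq_zero hb hp h
    exact ⟨hp0, Fintype.linearIndependent_iff.mp hli c (by simpa [hp0] using h)⟩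
  · have hfin : FiniteDimensional ℝ (Submodule.span ℝ (Set.range b)) :=
      FiniteDimensional.span_of_finite ℝ (Set.finite_range b)
    have hsup := Submodule.finrank_sup_add_finrank_inf_eq (restrictTotalDegree (Fin 2) ℝ 4)
      (Submodule.span ℝ (Set.range b))
    rw [(disjoint_restrictTotalDegree_span hb).eq_bot, finrank_bot, add_zero,
      finrank_restrictTotalDegree_two, finrank_span_eq_card hli, Fintype.card_fin] at hsup
    rw [hsup]
    decide
end
end
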